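/- Let n ≥ 1 and let X₁,…,Xₙ, Y₁,…,Yₙ, Z₁,…,Zₙ be random variables taking values in finite sets such that, conditioned on (X₁,…,Xₙ), the pairs (Y₁,Z₁),…,(Yₙ,Zₙ) are mutually independent, and for each k the pair (Y_k,Z_k) is conditionally independent of (X_j)_{j≠k} given X_k (a memoryless channel). Then I((X₁,…,Xₙ); (Y₁,…,Yₙ) | (Z₁,…,Zₙ)) ≤ Σ_{k=1}^n I(X_k; Y_k | Z_k). -/

import Mathlib

/-- The probability that the random variable `X` (on finite sample space `Ω`
with probability mass function `p`) takes the value `a`. -/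
noncomputable def prob {Ω α : Type*} [Fintype Ω] [DecidableEq α]
    (p : Ω → ℝ) (X : Ω → α) (a : α) : ℝ :=
  ∑ ω, if X ω = a then p ω else 0

/-- Shannon entropy (in nats) of a random variable on a finite probability space. -/
noncomputable def Hent {Ω α : Type*} [Fintype Ω] [Fintype α] [DecidableEq α]
    (p : Ω → ℝ) (X : Ω → α) : ℝ :=
  -∑ a, prob p X a * Real.log (prob p X a)

/-- Conditional entropy `H(X | Y)`. -/
noncomputable def condHent {Ω α β : Type*} [Fintype Ω] [Fintype α] [DecidableEq α]
    [Fintype β] [DecidableEq β] (p : Ω → ℝ) (X : Ω → α) (Y : Ω → β) : ℝ :=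
  Hent p (fun ω => (X ω, Y ω)) - Hent p Y

/-- Mutual information `I(X;Y)`. -/
noncomputable def mutInfo {Ω α β : Type*} [Fintype Ω] [Fintype α] [DecidableEq α]
    [Fintype β] [DecidableEq β] (p : Ω → ℝ) (X : Ω → α) (Y : Ω → β) : ℝ :=
  Hent p X + Hent p Y - Hent p (fun ω => (X ω, Y ω))

/-- Conditional mutual information `I(X;Y | Z)`. -/
noncomputable def condMutInfo {Ω α β γ : Type*} [Fintype Ω] [Fintype α] [DecidableEq α]
    [Fintype β] [DecidableEq β] [Fintype γ] [DecidableEq γ]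
    (p : Ω → ℝ) (X : Ω → α) (Y : Ω → β) (Z : Ω → γ) : ℝ :=
  Hent p (fun ω => (X ω, Z ω)) + Hent p (fun ω => (Y ω, Z ω))
    - Hent p (fun ω => (X ω, Y ω, Z ω)) - Hent p Z

/-- `X` and `Y` are conditionally independent given `Z`; equivalently the
Markov chain `X → Z → Y` holds. -/
def CondIndepRV {Ω α β γ : Type*} [Fintype Ω] [DecidableEq α] [DecidableEq β]
    [DecidableEq γ] (p : Ω → ℝ) (X : Ω → α) (Y : Ω → β) (Z : Ω → γ) : Prop :=
  ∀ x y z,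
    prob p (fun ω => (X ω, Y ω, Z ω)) (x, y, z) * prob p Z z =
      prob p (fun ω => (X ω, Z ω)) (x, z) * prob p (fun ω => (Y ω, Z ω)) (y, z)

/-- `p` is a probability mass function. -/
def IsProbMass {Ω : Type*} [Fintype Ω] (p : Ω → ℝ) : Prop :=
  (∀ ω, 0 ≤ p ω) ∧ ∑ ω, p ω = 1

section ProbLemmas

variable {Ω α β : Type*} [Fintype Ω] [DecidableEq α] [DecidableEq β] {p : Ω → ℝ}

lemma prob_nonneg (hp : ∀ ω, 0 ≤ p ω) (X : Ω → α) (a : α) : 0 ≤ prob p X a :=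
  Finset.sum_nonneg fun ω _ => by split_ifs <;> simp [hp ω]

lemma prob_self_pos (hp : ∀ ω, 0 ≤ p ω) (X : Ω → α) {ω : Ω} (hω : 0 < p ω) :
    0 < prob p X (X ω) :=
  Finset.sum_pos' (fun ω' _ => by split_ifs <;> simp [hp ω']) ⟨ω, Finset.mem_univ _, by simpa⟩

lemma prob_congr {X : Ω → α} {W : Ω → β} {a : α} {b : β} (h : ∀ ω, X ω = a ↔ W ω = b) :
    prob p X a = prob p W b := by
  simp only [prob, h]

/-- Marginalization: summing out the values of `B`. -/
lemma prob_eq_sum_prob {γ : Type*} [Fintype γ] [DecidableEq γ] {X : Ω → α} {W : Ω → β}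
    {B : Ω → γ} {a : α} {w : γ → β} (h : ∀ c ω, W ω = w c ↔ X ω = a ∧ B ω = c) :
    prob p X a = ∑ c, prob p W (w c) := by
  simp only [prob, h]
  rw [Finset.sum_comm]
  refine Finset.sum_congr rfl fun ω _ => ?_
  by_cases hX : X ω = a <;> simp [hX]

/-- Expectation of a function of `X`, in terms of the law of `X`. -/
lemma sum_prob_mul [Fintype α] (X : Ω → α) (f : α → ℝ) :
    ∑ a, prob p X a * f a = ∑ ω, p ω * f (X ω) := by
  simp only [prob, Finset.sum_mul]
  rw [Finset.sum_comm]
  refine Finset.sum_congr rfl fun ω _ => ?_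
  simp [ite_mul]

lemma sum_prob [Fintype α] (X : Ω → α) : ∑ a, prob p X a = ∑ ω, p ω := by
  simpa using sum_prob_mul (p := p) X fun _ => 1

lemma Hent_eq_neg_sum [Fintype α] (X : Ω → α) :
    Hent p X = -∑ ω, p ω * Real.log (prob p X (X ω)) := by
  rw [Hent, sum_prob_mul X fun a => Real.log (prob p X a)]

lemma condMutInfo_eq_sum [Fintype α] [Fintype β] {γ : Type*} [Fintype γ] [DecidableEq γ]
    (X : Ω → α) (Y : Ω → β) (Z : Ω → γ) :
    condMutInfo p X Y Z = ∑ ω, p ω *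
      (Real.log (prob p (fun ω => (X ω, Y ω, Z ω)) (X ω, Y ω, Z ω)) + Real.log (prob p Z (Z ω))
        - Real.log (prob p (fun ω => (X ω, Z ω)) (X ω, Z ω))
        - Real.log (prob p (fun ω => (Y ω, Z ω)) (Y ω, Z ω))) := by
  simp only [condMutInfo, Hent_eq_neg_sum, mul_sub, mul_add, Finset.sum_sub_distrib,
    Finset.sum_add_distrib]
  ring

end ProbLemmas

section Memoryless

variable {Ω : Type*} {n : ℕ} [Fintype Ω] {𝒳 𝒴 𝒵 : Fin n → Type*}
  [∀ k, DecidableEq (𝒳 k)] [∀ k, Fintype (𝒴 k)] [∀ k, DecidableEq (𝒴 k)]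
  [∀ k, DecidableEq (𝒵 k)] {p : Ω → ℝ}

/-- The mean likelihood ratio of `P(z) ∏ P(y_k | z_k)` against `P(y, z)` is at most one. -/
lemma sum_mul_likelihood_ratio_le_one [∀ k, Fintype (𝒵 k)] (hp : IsProbMass p)
    (Y : ∀ k : Fin n, Ω → 𝒴 k) (Z : ∀ k : Fin n, Ω → 𝒵 k) :
    ∑ ω, p ω * (prob p (fun ω k => Z k ω) (fun k => Z k ω)
      * (∏ k, prob p (fun ω => (Y k ω, Z k ω)) (Y k ω, Z k ω) / prob p (Z k) (Z k ω))
      / prob p (fun ω => ((fun k => Y k ω), fun k => Z k ω))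
          ((fun k => Y k ω), fun k => Z k ω)) ≤ 1 := by
  set q : (∀ k, 𝒴 k) × (∀ k, 𝒵 k) → ℝ := fun w => prob p (fun ω k => Z k ω) w.2
    * ∏ k, prob p (fun ω => (Y k ω, Z k ω)) (w.1 k, w.2 k) / prob p (Z k) (w.2 k) with hq
  set P : (∀ k, 𝒴 k) × (∀ k, 𝒵 k) → ℝ :=
    prob p (fun ω => ((fun k => Y k ω), fun k => Z k ω))
  have hq0 : ∀ w, 0 ≤ q w := fun w => mul_nonneg (prob_nonneg hp.1 _ _)
    (Finset.prod_nonneg fun k _ => div_nonneg (prob_nonneg hp.1 _ _) (prob_nonneg hp.1 _ _))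
  calc _ = ∑ w, P w * (q w / P w) :=
        (sum_prob_mul (fun ω => ((fun k => Y k ω), fun k => Z k ω)) fun w => q w / P w).symm
    _ ≤ ∑ w, q w := by
        refine Finset.sum_le_sum fun w _ => ?_
        by_cases h : P w = 0
        · simp [h, hq0 w]
        · rw [mul_div_cancel₀ _ h]
    _ = ∑ z : ∀ k, 𝒵 k, prob p (fun ω k => Z k ω) z
          * ∏ k, ∑ y, prob p (fun ω => (Y k ω, Z k ω)) (y, z k) / prob p (Z k) (z k) := by
        rw [Fintype.sum_prod_type_right]
        simp only [hq, Finset.prod_univ_sum, Fintype.piFinset_univ, Finset.mul_sum]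
    _ ≤ ∑ z : ∀ k, 𝒵 k, prob p (fun ω k => Z k ω) z := by
        refine Finset.sum_le_sum fun z _ => mul_le_of_le_one_right (prob_nonneg hp.1 _ _) ?_
        refine Finset.prod_le_one (fun k _ => Finset.sum_nonneg fun y _ =>
          div_nonneg (prob_nonneg hp.1 _ _) (prob_nonneg hp.1 _ _)) fun k _ => ?_
        rw [← Finset.sum_div, ← prob_eq_sum_prob (X := Z k) (a := z k) (B := Y k)
          (by intro c ω; simp [and_comm])]
        exact div_self_le_one _
    _ = 1 := by rw [sum_prob, hp.2]

lemma prob_mul_pow_eq_prod_of_marginal {X : ∀ k : Fin n, Ω → 𝒳 k}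
    {Y : ∀ k : Fin n, Ω → 𝒴 k} {Z : ∀ k : Fin n, Ω → 𝒵 k} {x : ∀ k, 𝒳 k} {c : ℝ}
    (h : ∀ yz : ∀ k, 𝒴 k × 𝒵 k,
      prob p (fun ω => ((fun k => X k ω), fun k => (Y k ω, Z k ω))) (x, yz) * c
        = ∏ k, prob p (fun ω => ((fun k' => X k' ω), (Y k ω, Z k ω))) (x, yz k))
    (z : ∀ k, 𝒵 k) :
    prob p (fun ω => ((fun k => X k ω), fun k => Z k ω)) (x, z) * c
      = ∏ k, prob p (fun ω => ((fun k' => X k' ω), Z k ω)) (x, z k) := by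
  rw [prob_eq_sum_prob (W := fun ω => ((fun k => X k ω), fun k => (Y k ω, Z k ω)))
    (B := fun ω k => Y k ω) (w := fun y => (x, fun k => (y k, z k)))
    (by intro y ω; simp only [Prod.mk.injEq, funext_iff, forall_and]; tauto), Finset.sum_mul]
  simp only [h]
  have : ∀ k, prob p (fun ω => ((fun k' => X k' ω), Z k ω)) (x, z k)
      = ∑ y, prob p (fun ω => ((fun k' => X k' ω), (Y k ω, Z k ω))) (x, (y, z k)) := fun k =>
    prob_eq_sum_prob (B := Y k) (by intro y ω; simp only [Prod.mk.injEq]; tauto)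
  simp only [this, Finset.prod_univ_sum, Fintype.piFinset_univ]

/-- Memorylessness, with the full input tuple in place of the other inputs. -/
lemma prob_mul_eq_of_condIndepRV {β : Type*} [DecidableEq β] {X : ∀ k : Fin n, Ω → 𝒳 k}
    {B : Ω → β} {k : Fin n}
    (h : CondIndepRV p B (fun ω => fun j : {j : Fin n // j ≠ k} => X j.val ω) (X k))
    (x : ∀ k, 𝒳 k) (b : β) :
    prob p (fun ω => ((fun k' => X k' ω), B ω)) (x, b) * prob p (X k) (x k)
      = prob p (fun ω => (X k ω, B ω)) (x k, b) * prob p (fun ω k' => X k' ω) x := by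
  have key : ∀ ω, ((fun k' => X k' ω) = x) ↔
      ((fun j : {j : Fin n // j ≠ k} => X j.val ω) = fun j : {j : Fin n // j ≠ k} => x j.val) ∧ X k ω = x k := by
    intro ω
    constructor
    · rintro rfl
      exact ⟨rfl, rfl⟩
    · rintro ⟨h1, h2⟩
      funext j
      by_cases hj : j = k
      · subst hj; exact h2
      · exact congr_fun h1 ⟨j, hj⟩
  have h1 : prob p (fun ω => ((fun k' => X k' ω), B ω)) (x, b)
      = prob p (fun ω => (B ω, (fun j : {j : Fin n // j ≠ k} => X j.val ω), X k ω))
        (b, (fun j => x j.val), x k) :=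
    prob_congr fun ω => by simp only [Prod.mk.injEq, key]; tauto
  have h2 : prob p (fun ω k' => X k' ω) x
      = prob p (fun ω => ((fun j : {j : Fin n // j ≠ k} => X j.val ω), X k ω))
        ((fun j => x j.val), x k) :=
    prob_congr fun ω => by simp only [Prod.mk.injEq, key]
  have h3 : prob p (fun ω => (X k ω, B ω)) (x k, b) = prob p (fun ω => (B ω, X k ω)) (b, x k) :=
    prob_congr fun ω => by simp only [Prod.mk.injEq]; tauto
  rw [h1, h2, h3]
  exact h b (fun j => x j.val) (x k)

end Memoryless

/-- Single-letterization for a memoryless wiretap channel: if, conditioned on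
`(X₁,…,Xₙ)`, the pairs `(Y_k, Z_k)` are mutually independent, and for each `k`
the pair `(Y_k, Z_k)` is conditionally independent of `(X_j)_{j ≠ k}` given
`X_k`, then `I((X₁,…,Xₙ); (Y₁,…,Yₙ) | (Z₁,…,Zₙ)) ≤ ∑_k I(X_k; Y_k | Z_k)`. -/
theorem stmt4 {Ω : Type*} {n : ℕ} (hn : 1 ≤ n)
    {𝒳 𝒴 𝒵 : Fin n → Type*} [Fintype Ω]
    [∀ k, Fintype (𝒳 k)] [∀ k, DecidableEq (𝒳 k)]
    [∀ k, Fintype (𝒴 k)] [∀ k, DecidableEq (𝒴 k)]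
    [∀ k, Fintype (𝒵 k)] [∀ k, DecidableEq (𝒵 k)]
    (p : Ω → ℝ) (hp : IsProbMass p)
    (X : ∀ k : Fin n, Ω → 𝒳 k) (Y : ∀ k : Fin n, Ω → 𝒴 k)
    (Z : ∀ k : Fin n, Ω → 𝒵 k)
    -- conditioned on `(X₁,…,Xₙ)` the pairs `(Y_k, Z_k)` are mutually independent:
    (hCI : ∀ (x : ∀ k, 𝒳 k) (yz : ∀ k, 𝒴 k × 𝒵 k),
      prob p (fun ω => ((fun k => X k ω), fun k => (Y k ω, Z k ω))) (x, yz)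
          * (prob p (fun ω => fun k => X k ω) x) ^ (n - 1)
        = ∏ k, prob p (fun ω => ((fun k' => X k' ω), (Y k ω, Z k ω))) (x, yz k))
    -- `(Y_k, Z_k)` is conditionally independent of `(X_j)_{j ≠ k}` given `X_k`:
    (hMem : ∀ k : Fin n, CondIndepRV p (fun ω => (Y k ω, Z k ω))
      (fun ω => fun j : {j : Fin n // j ≠ k} => X j.val ω) (X k)) :
    condMutInfo p (fun ω => fun k => X k ω) (fun ω => fun k => Y k ω)
        (fun ω => fun k => Z k ω)
      ≤ ∑ k : Fin n, condMutInfo p (X k) (Y k) (Z k) := by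
  have hMemZ : ∀ (k : Fin n) (x : ∀ k, 𝒳 k) (z : 𝒵 k),
      prob p (fun ω => ((fun k' => X k' ω), Z k ω)) (x, z) * prob p (X k) (x k)
        = prob p (fun ω => (X k ω, Z k ω)) (x k, z) * prob p (fun ω k' => X k' ω) x := by
    intro k x z
    rw [prob_eq_sum_prob (W := fun ω => ((fun k' => X k' ω), (Y k ω, Z k ω))) (B := Y k)
        (w := fun y => (x, (y, z))) (by intro y ω; simp only [Prod.mk.injEq]; tauto),
      prob_eq_sum_prob (X := fun ω => (X k ω, Z k ω)) (W := fun ω => (X k ω, (Y k ω, Z k ω)))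
        (B := Y k) (w := fun y => (x k, (y, z)))
        (by intro y ω; simp only [Prod.mk.injEq]; tauto), Finset.sum_mul, Finset.sum_mul]
    exact Finset.sum_congr rfl fun y _ => prob_mul_eq_of_condIndepRV (hMem k) x (y, z)
  simp only [condMutInfo_eq_sum]
  rw [Finset.sum_comm, ← sub_nonpos, ← Finset.sum_sub_distrib]
  refine le_trans (Finset.sum_le_sum (g := fun ω =>
    p ω * (prob p (fun ω k => Z k ω) (fun k => Z k ω)
      * (∏ k, prob p (fun ω => (Y k ω, Z k ω)) (Y k ω, Z k ω) / prob p (Z k) (Z k ω))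
      / prob p (fun ω => ((fun k => Y k ω), fun k => Z k ω))
          ((fun k => Y k ω), fun k => Z k ω)) - p ω) fun ω _ => ?_) ?_
  · rcases (hp.1 ω).eq_or_lt with h0 | hω
    · simp [← h0]
    rw [← Finset.mul_sum, ← mul_sub, ← mul_sub_one]
    refine mul_le_mul_of_nonneg_left ?_ hω.le
    have hx := prob_self_pos hp.1 (fun ω k => X k ω) hω
    have hz := prob_self_pos hp.1 (fun ω k => Z k ω) hω
    have hyz := prob_self_pos hp.1 (fun ω => ((fun k => Y k ω), fun k => Z k ω)) hω
    have hxz := prob_self_pos hp.1 (fun ω => ((fun k => X k ω), fun k => Z k ω)) hω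
    have hxyz := prob_self_pos hp.1 (fun ω => ((fun k => X k ω), fun k => (Y k ω, Z k ω))) hω
    have hxk := fun k => prob_self_pos hp.1 (X k) hω
    have hzk := fun k => prob_self_pos hp.1 (Z k) hω
    have hyzk := fun k => prob_self_pos hp.1 (fun ω => (Y k ω, Z k ω)) hω
    have hxzk := fun k => prob_self_pos hp.1 (fun ω => (X k ω, Z k ω)) hω
    have hxyzk := fun k => prob_self_pos hp.1 (fun ω => (X k ω, (Y k ω, Z k ω))) hω
    have hXzk := fun k => prob_self_pos hp.1 (fun ω => ((fun k => X k ω), Z k ω)) hω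
    have hXyzk := fun k =>
      prob_self_pos hp.1 (fun ω => ((fun k => X k ω), (Y k ω, Z k ω))) hω
    have log1 := congrArg Real.log (hCI (fun k => X k ω) fun k => (Y k ω, Z k ω))
    have log2 := congrArg Real.log (prob_mul_pow_eq_prod_of_marginal
      (hCI fun k => X k ω) fun k => Z k ω)
    rw [Real.log_mul hxyz.ne' (pow_pos hx _).ne', Real.log_prod fun k _ => (hXyzk k).ne'] at log1
    rw [Real.log_mul hxz.ne' (pow_pos hx _).ne', Real.log_prod fun k _ => (hXzk k).ne'] at log2
    have log3 := fun k => congrArg Real.log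
      (prob_mul_eq_of_condIndepRV (hMem k) (fun k => X k ω) (Y k ω, Z k ω))
    have log4 := fun k => congrArg Real.log (hMemZ k (fun k => X k ω) (Z k ω))
    have hsum : ∑ k, Real.log (prob p (fun ω => ((fun k => X k ω), (Y k ω, Z k ω)))
          ((fun k => X k ω), (Y k ω, Z k ω)))
        - ∑ k, Real.log (prob p (fun ω => ((fun k => X k ω), Z k ω)) ((fun k => X k ω), Z k ω))
        = ∑ k, Real.log (prob p (fun ω => (X k ω, (Y k ω, Z k ω))) (X k ω, (Y k ω, Z k ω)))
        - ∑ k, Real.log (prob p (fun ω => (X k ω, Z k ω)) (X k ω, Z k ω)) := by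
      rw [← Finset.sum_sub_distrib, ← Finset.sum_sub_distrib]
      refine Finset.sum_congr rfl fun k _ => ?_
      have h3 := log3 k
      have h4 := log4 k
      rw [Real.log_mul (hXyzk k).ne' (hxk k).ne', Real.log_mul (hxyzk k).ne' hx.ne'] at h3
      rw [Real.log_mul (hXzk k).ne' (hxk k).ne', Real.log_mul (hxzk k).ne' hx.ne'] at h4
      linarith
    have hprod : 0 < ∏ k, prob p (fun ω => (Y k ω, Z k ω)) (Y k ω, Z k ω)
        / prob p (Z k) (Z k ω) := Finset.prod_pos fun k _ => div_pos (hyzk k) (hzk k)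
    refine le_trans (le_of_eq ?_)
      (Real.log_le_sub_one_of_pos (div_pos (mul_pos hz hprod) hyz))
    rw [Real.log_div (mul_pos hz hprod).ne' hyz.ne', Real.log_mul hz.ne' hprod.ne',
      Real.log_prod fun k _ => (div_pos (hyzk k) (hzk k)).ne',
      Finset.sum_congr rfl fun k _ => Real.log_div (hyzk k).ne' (hzk k).ne']
    have htriple : prob p (fun ω => ((fun k => X k ω), (fun k => Y k ω), fun k => Z k ω))
          ((fun k => X k ω), (fun k => Y k ω), fun k => Z k ω)
        = prob p (fun ω => ((fun k => X k ω), fun k => (Y k ω, Z k ω)))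
          ((fun k => X k ω), fun k => (Y k ω, Z k ω)) :=
      prob_congr fun ω' => by
        simp only [Prod.mk.injEq, funext_iff, forall_and]
    rw [htriple]
    simp only [Finset.sum_sub_distrib, Finset.sum_add_distrib]
    linarith
  · rw [Finset.sum_sub_distrib, hp.2]
    linarith [sum_mul_likelihood_ratio_le_one hp Y Z]
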